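/- Fix an integer d ≥ 2. For every positive integer N there exists a positive integer n such that the strength of the polynomial x_1^d + x_2^d + ⋯ + x_n^d in ℂ[x_1, …, x_n] is at least N; that is, x_1^d + ⋯ + x_n^d cannot be written as Σ_{l=1}^{N} g_l h_l with each g_l, h_l homogeneous of positive degree. In other words, the strength of the power-sum polynomials Σ_{s=1}^n x_s^d is unbounded as n → ∞. -/

import Mathlib

open MvPolynomial

/-- `f` is a sum of `c` products of two homogeneous polynomials of positive degree. -/
def IsSumOfProducts {σ : Type*} (c : ℕ) (f : MvPolynomial σ ℂ) : Prop :=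
  ∃ G H : Fin c → MvPolynomial σ ℂ,
    (∀ l, ∃ d : ℕ, 0 < d ∧ (G l).IsHomogeneous d) ∧
    (∀ l, ∃ d : ℕ, 0 < d ∧ (H l).IsHomogeneous d) ∧
    f = ∑ l, G l * H l

/-- Substitute `0` for the variables of index less than `k`. -/
noncomputable def killVars (K : Type*) [Field K] (n k : ℕ) :
    MvPolynomial (Fin n) K →ₐ[K] MvPolynomial (Fin n) K :=
  aeval fun i => if i.val < k then 0 else X i

theorem killVars_X (K : Type*) [Field K] {n : ℕ} (k : ℕ) (i : Fin n) :
    killVars K n k (X i) = if i.val < k then 0 else X i := by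
  simp [killVars]

theorem killVars_comp_killVars_of_le (K : Type*) [Field K] {n k l : ℕ} (h : k ≤ l) :
    (killVars K n l).comp (killVars K n k) = killVars K n l := by
  ext1 i
  rw [AlgHom.comp_apply, killVars_X]
  split_ifs with hi
  · rw [killVars_X, if_pos (hi.trans_le h), map_zero]
  · rfl

theorem killVars_eq_C_constantCoeff (K : Type*) [Field K] {n : ℕ} (p : MvPolynomial (Fin n) K) :
    killVars K n n p = C (constantCoeff p) := by
  have : killVars K n n =
      (Algebra.ofId K (MvPolynomial (Fin n) K)).comp (aeval (fun _ : Fin n => (0 : K))) := by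
    ext1 i
    simp [killVars_X]
  rw [this, AlgHom.comp_apply, aeval_zero']
  simp [Algebra.ofId_apply, algebraMap_eq]

theorem le_height_ker_killVars (K : Type*) [Field K] {n k : ℕ} (h : k ≤ n) :
    (k : ℕ∞) ≤ (RingHom.ker (killVars K n k)).height := by
  induction k with
  | zero => simp
  | succ k ih =>
    have hlt : RingHom.ker (killVars K n k) < RingHom.ker (killVars K n (k + 1)) := by
      refine SetLike.lt_iff_le_and_exists.mpr ⟨fun p hp => ?_, X ⟨k, h⟩, ?_, ?_⟩
      · rw [RingHom.mem_ker] at hp ⊢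
        rw [← killVars_comp_killVars_of_le K k.le_succ, AlgHom.comp_apply, hp, map_zero]
      · simp [RingHom.mem_ker, killVars_X]
      · simp [RingHom.mem_ker, killVars_X]
    have := RingHom.ker_isPrime (killVars K n k)
    have := RingHom.ker_isPrime (killVars K n (k + 1))
    calc ((k + 1 : ℕ) : ℕ∞) = k + 1 := by push_cast; rfl
      _ ≤ (RingHom.ker (killVars K n k)).height + 1 := by gcongr; exact ih (by omega)
      _ ≤ _ := by
        exact Ideal.height_add_one_le_of_lt_of_isPrime hlt

/-- The ideal of the origin in affine `n`-space has height at least `n`. -/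
theorem le_height_ker_constantCoeff (K : Type*) [Field K] (n : ℕ) :
    (n : ℕ∞) ≤ (RingHom.ker (constantCoeff : MvPolynomial (Fin n) K →+* K)).height := by
  convert le_height_ker_killVars K (le_refl n) using 2
  ext p
  simp [RingHom.mem_ker, killVars_eq_C_constantCoeff]

theorem ker_constantCoeff_le {K : Type*} [Field K] {n : ℕ} {P : Ideal (MvPolynomial (Fin n) K)}
    (hP : ∀ i, X i ∈ P) : RingHom.ker (constantCoeff : MvPolynomial (Fin n) K →+* K) ≤ P := by
  have hq : (Ideal.Quotient.mk P) = ((Ideal.Quotient.mk P).comp C).comp constantCoeff := by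
    ext i
    · simp
    · simpa using Ideal.Quotient.eq_zero_iff_mem.mpr (hP i)
  intro p hp
  rw [RingHom.mem_ker] at hp
  rw [← Ideal.Quotient.eq_zero_iff_mem, hq]
  simp [hp]

/-- If polynomials vanishing at the origin generate an ideal containing a power of every variable,
then there are at least as many of them as variables. -/
theorem le_card_of_forall_X_pow_mem_span {K : Type*} [Field K] {n : ℕ}
    (s : Finset (MvPolynomial (Fin n) K)) (hs : ∀ p ∈ s, constantCoeff p = 0)
    (e : ℕ) (he : ∀ i, X i ^ e ∈ Ideal.span (s : Set (MvPolynomial (Fin n) K))) :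
    n ≤ s.card := by
  have hmin : RingHom.ker (constantCoeff : MvPolynomial (Fin n) K →+* K) ∈
      (Ideal.span (s : Set (MvPolynomial (Fin n) K))).minimalPrimes := by
    refine ⟨⟨RingHom.ker_isPrime _, Ideal.span_le.mpr hs⟩, fun P hP _ => ?_⟩
    exact ker_constantCoeff_le fun i => hP.1.mem_of_pow_mem e (hP.2 (he i))
  exact_mod_cast (le_height_ker_constantCoeff K n).trans
    (Ideal.height_le_card_of_mem_minimalPrimes_span_finset hmin)

theorem constantCoeff_eq_zero_of_isHomogeneous {σ K : Type*} [Field K] {p : MvPolynomial σ K}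
    {d : ℕ} (hp : p.IsHomogeneous d) (hd : 0 < d) : constantCoeff p = 0 := by
  rw [constantCoeff_eq]
  exact hp.coeff_eq_zero (by simpa using hd.ne)

/-- The partial derivatives of `∑ l, G l * H l` lie in any ideal containing all `G l` and `H l`. -/
theorem pderiv_sum_mul_mem {σ ι K : Type*} [Fintype ι] [Field K] {I : Ideal (MvPolynomial σ K)}
    {G H : ι → MvPolynomial σ K} (hG : ∀ l, G l ∈ I) (hH : ∀ l, H l ∈ I) (i : σ) :
    pderiv i (∑ l, G l * H l) ∈ I := by
  rw [map_sum]
  refine I.sum_mem fun l _ => ?_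
  rw [pderiv_mul]
  exact I.add_mem (I.mul_mem_left _ (hH l)) (I.mul_mem_right _ (hG l))

theorem pderiv_sum_X_pow {K : Type*} [Field K] {n : ℕ} (d : ℕ) (i : Fin n) :
    pderiv i (∑ s : Fin n, (X s : MvPolynomial (Fin n) K) ^ d) = C (d : K) * X i ^ (d - 1) := by
  rw [map_sum, Finset.sum_eq_single i]
  · simp [Derivation.leibniz_pow]
  · intro j _ hj
    simp [Derivation.leibniz_pow, pderiv_X_of_ne hj]
  · simp

theorem stmt11 (d : ℕ) (hd : 2 ≤ d) :
    ∀ N : ℕ, 0 < N → ∃ n : ℕ, 0 < n ∧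
      ¬ IsSumOfProducts N (∑ s : Fin n, (X s : MvPolynomial (Fin n) ℂ) ^ d) := by
  classical
  intro N _
  refine ⟨2 * N + 1, by omega, fun ⟨G, H, hG, hH, hf⟩ => ?_⟩
  let s := Finset.univ.image G ∪ Finset.univ.image H
  have hcard : s.card ≤ 2 * N := by
    have h1 : s.card ≤ _ := Finset.card_union_le (Finset.univ.image G) (Finset.univ.image H)
    have h2 := Finset.card_image_le (s := Finset.univ) (f := G)
    have h3 := Finset.card_image_le (s := Finset.univ) (f := H)
    simp only [Finset.card_univ, Fintype.card_fin] at h2 h3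
    omega
  have hs : ∀ p ∈ s, constantCoeff p = 0 := by
    intro p hp
    simp only [s, Finset.mem_union, Finset.mem_image, Finset.mem_univ, true_and] at hp
    rcases hp with ⟨l, rfl⟩ | ⟨l, rfl⟩
    · obtain ⟨e, he, hom⟩ := hG l
      exact constantCoeff_eq_zero_of_isHomogeneous hom he
    · obtain ⟨e, he, hom⟩ := hH l
      exact constantCoeff_eq_zero_of_isHomogeneous hom he
  have hX : ∀ i, X i ^ (d - 1) ∈
      Ideal.span (s : Set (MvPolynomial (Fin (2 * N + 1)) ℂ)) := by
    intro i
    have hmem := pderiv_sum_mul_mem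
      (fun l => Ideal.subset_span (Finset.mem_coe.mpr (by simp [s]) : G l ∈ (s : Set _)))
      (fun l => Ideal.subset_span (Finset.mem_coe.mpr (by simp [s]) : H l ∈ (s : Set _))) i
    rw [← hf, pderiv_sum_X_pow] at hmem
    have hd0 : (d : ℂ) ≠ 0 := by exact_mod_cast (by omega : d ≠ 0)
    exact (Ideal.unit_mul_mem_iff_mem _ (hd0.isUnit.map C)).mp hmem
  have := le_card_of_forall_X_pow_mem_span s hs _ hX
  omega
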